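/- In a matching market in which all choice functions are path-independent and cardinal monotone, let μ1 be a stable matching and suppose w ∈ P_f(μ1) for some firm f and worker w. Then there exists a stable matching μ2 such that μ2 ⪰ μ1 and w ∈ μ2(f). -/

import Mathlib

/-- A matching market: finite disjoint sets of firms `F` and workers `W`; each firm `f`
has a set `accF f ⊆ W` of acceptable workers and a choice function `Cf f` on subsets of
`accF f`; each worker `w` has a set `accW w ⊆ F` and a choice function `Cw w`, where
`f ∈ accW w ↔ w ∈ accF f`. -/
structure Market (F W : Type*) [Fintype F] [Fintype W] [DecidableEq F] [DecidableEq W] where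
  accF : F → Finset W
  accW : W → Finset F
  compat : ∀ f w, f ∈ accW w ↔ w ∈ accF f
  Cf : F → Finset W → Finset W
  Cw : W → Finset F → Finset F
  CfSub : ∀ f S, Cf f S ⊆ S
  CwSub : ∀ w S, Cw w S ⊆ S

namespace Market

variable {F W : Type*} [Fintype F] [Fintype W] [DecidableEq F] [DecidableEq W]

/-- The set `μ(w)` of firms matched to worker `w` under the matching `μ`. -/
def mw (M : Market F W) (μ : F → Finset W) (w : W) : Finset F :=
  Finset.univ.filter (fun f => w ∈ μ f)

/-- `μ` is a matching: each firm is matched to acceptable workers. -/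
def IsMatching (M : Market F W) (μ : F → Finset W) : Prop :=
  ∀ f, μ f ⊆ M.accF f

/-- `μ` is individually rational. -/
def IndRational (M : Market F W) (μ : F → Finset W) : Prop :=
  (∀ f, M.Cf f (μ f) = μ f) ∧ (∀ w, M.Cw w (M.mw μ w) = M.mw μ w)

/-- The acceptable pair `(f, w)` blocks `μ`. -/
def Blocks (M : Market F W) (μ : F → Finset W) (f : F) (w : W) : Prop :=
  w ∈ M.accF f ∧ w ∉ μ f ∧
    w ∈ M.Cf f (insert w (μ f)) ∧ f ∈ M.Cw w (insert f (M.mw μ w))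

/-- `μ` is a stable matching. -/
def Stable (M : Market F W) (μ : F → Finset W) : Prop :=
  M.IsMatching μ ∧ M.IndRational μ ∧ ∀ f w, ¬ M.Blocks μ f w

/-- `Dom M μ2 μ1` is the partial order `μ2 ⪰ μ1` on stable matchings:
`C_f(μ2(f) ∪ μ1(f)) = μ2(f)` for every firm `f`. -/
def Dom (M : Market F W) (μ2 μ1 : F → Finset W) : Prop :=
  ∀ f, M.Cf f (μ2 f ∪ μ1 f) = μ2 f

/-- `φ(f)`: the set of stable partners of firm `f`. -/
def phi (M : Market F W) (f : F) : Set W :=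
  {w | ∃ μ, M.Stable μ ∧ w ∈ μ f}

/-- `P_f(μ) = {w ∈ φ(f) : w ∈ C_f(μ(f) ∪ {w})}`. -/
def Pf (M : Market F W) (μ : F → Finset W) (f : F) : Set W :=
  {w | w ∈ M.phi f ∧ w ∈ M.Cf f (insert w (μ f))}

/-- The P-set `P(μ) = {(f, w) : f ∈ F, w ∈ P_f(μ)}`. -/
def Pset (M : Market F W) (μ : F → Finset W) : Set (F × W) :=
  {p | p.2 ∈ M.Pf μ p.1}

/-- All choice functions of the market are path-independent and cardinal monotone
(on their domains). -/
def PathIndepCM (M : Market F W) : Prop :=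
  (∀ f, ∀ S ⊆ M.accF f, ∀ T ⊆ M.accF f, M.Cf f (S ∪ T) = M.Cf f (M.Cf f S ∪ T)) ∧
  (∀ f, ∀ S T : Finset W, S ⊆ T → T ⊆ M.accF f → (M.Cf f S).card ≤ (M.Cf f T).card) ∧
  (∀ w, ∀ S ⊆ M.accW w, ∀ T ⊆ M.accW w, M.Cw w (S ∪ T) = M.Cw w (M.Cw w S ∪ T)) ∧
  (∀ w, ∀ S T : Finset F, S ⊆ T → T ⊆ M.accW w → (M.Cw w S).card ≤ (M.Cw w T).card)

end Market

section PathIndependent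

variable {α : Type*} [DecidableEq α] {U : Finset α} {C : Finset α → Finset α}

/-- A path-independent choice function is substitutable. -/
theorem mem_choice_of_subset (hsub : ∀ S, C S ⊆ S)
    (hpi : ∀ S ⊆ U, ∀ T ⊆ U, C (S ∪ T) = C (C S ∪ T))
    {S T : Finset α} (hST : S ⊆ T) (hT : T ⊆ U) {x : α} (hxS : x ∈ S) (hx : x ∈ C T) :
    x ∈ C S := by
  have key := hpi S (hST.trans hT) (T \ S) (Finset.sdiff_subset.trans hT)
  rw [Finset.union_sdiff_of_subset hST] at key
  rw [key] at hx
  have := hsub _ hx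
  simp only [Finset.mem_union, Finset.mem_sdiff] at this
  tauto

/-- A path-independent choice function does not depend on rejected elements. -/
theorem choice_eq_of_choice_subset
    (hpi : ∀ S ⊆ U, ∀ T ⊆ U, C (S ∪ T) = C (C S ∪ T))
    {S T : Finset α} (hST : S ⊆ T) (hT : T ⊆ U) (h : C T ⊆ S) : C S = C T := by
  have key := hpi T hT S (hST.trans hT)
  rwa [Finset.union_eq_left.2 hST, Finset.union_eq_right.2 h, eq_comm] at key

end PathIndependent

namespace Market

variable {F W : Type*} [Fintype F] [Fintype W] [DecidableEq F] [DecidableEq W]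
  {M : Market F W} {A B : F → Finset W}

theorem mem_mw {μ : F → Finset W} {f : F} {w : W} : f ∈ M.mw μ w ↔ w ∈ μ f := by
  simp [mw]

theorem IsMatching.mw_subset (hA : M.IsMatching A) (w : W) : M.mw A w ⊆ M.accW w :=
  fun f hf => (M.compat f w).2 (hA f (mem_mw.1 hf))

theorem sum_card_mw (M : Market F W) (μ : F → Finset W) :
    ∑ w, (M.mw μ w).card = ∑ f, (μ f).card := by
  have := Finset.sum_card_bipartiteAbove_eq_sum_card_bipartiteBelow
    (s := (Finset.univ : Finset F)) (t := (Finset.univ : Finset W)) (fun f w => w ∈ μ f)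
  simpa [Finset.bipartiteAbove, Finset.bipartiteBelow, mw] using this.symm

/-- The firm-side pointwise choice from two matchings. -/
def join (M : Market F W) (A B : F → Finset W) (f : F) : Finset W := M.Cf f (A f ∪ B f)

theorem join_comm (M : Market F W) (A B : F → Finset W) : M.join A B = M.join B A := by
  funext f
  rw [join, join, Finset.union_comm]

theorem join_isMatching (hA : M.IsMatching A) (hB : M.IsMatching B) :
    M.IsMatching (M.join A B) :=
  fun f => (M.CfSub f _).trans (Finset.union_subset (hA f) (hB f))

theorem mem_or_mem_of_mem_join {f : F} {w : W} (hw : w ∈ M.join A B f) : w ∈ A f ∨ w ∈ B f :=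
  Finset.mem_union.1 (M.CfSub f _ hw)

theorem mem_choice_insert_of_mem_join (h : M.PathIndepCM) (hA : M.IsMatching A)
    (hB : M.IsMatching B) {f : F} {w : W} (hw : w ∈ M.join A B f) :
    w ∈ M.Cf f (insert w (A f)) :=
  mem_choice_of_subset (M.CfSub f) (h.1 f)
    (Finset.insert_subset (M.CfSub f _ hw) Finset.subset_union_left)
    (Finset.union_subset (hA f) (hB f)) (Finset.mem_insert_self _ _) hw

theorem mem_choice_insert_of_mem (hA : M.Stable A) {f : F} {w : W} (hw : w ∈ A f) :
    w ∈ M.Cf f (insert w (A f)) := by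
  rwa [Finset.insert_eq_of_mem hw, hA.2.1.1 f]

/-- At a stable matching, a worker facing their partners and firms that would accept them
chooses their partners. -/
theorem Stable.choice_eq_mw (h : M.PathIndepCM) (hA : M.Stable A) {w : W} {T : Finset F}
    (hT : T ⊆ M.accW w) (hAT : M.mw A w ⊆ T)
    (hacc : ∀ f ∈ T, w ∈ M.Cf f (insert w (A f))) : M.Cw w T = M.mw A w := by
  have hsub : M.Cw w T ⊆ M.mw A w := by
    intro f hf
    by_contra hfA
    have hfT := M.CwSub w _ hf
    exact hA.2.2 f w ⟨(M.compat f w).1 (hT hfT), fun hw => hfA (mem_mw.2 hw), hacc f hfT,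
      mem_choice_of_subset (M.CwSub w) (h.2.2.1 w) (Finset.insert_subset hfT hAT) hT
        (Finset.mem_insert_self _ _) hf⟩
  rw [← choice_eq_of_choice_subset (h.2.2.1 w) hAT hT hsub, hA.2.1.2 w]

/-- A worker's partners under the join are all kept against any further firms that would
accept the worker at both stable matchings. -/
theorem mem_choice_of_mem_join (h : M.PathIndepCM) (hA : M.Stable A) (hB : M.Stable B)
    {w : W} {T : Finset F} (hT : T ⊆ M.accW w)
    (haccA : ∀ f ∈ T, w ∈ M.Cf f (insert w (A f)))
    (haccB : ∀ f ∈ T, w ∈ M.Cf f (insert w (B f)))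
    {f : F} (hfT : f ∈ T) (hf : w ∈ M.join A B f) : f ∈ M.Cw w T := by
  have aux : ∀ μ : F → Finset W, M.Stable μ → (∀ f ∈ T, w ∈ M.Cf f (insert w (μ f))) →
      w ∈ μ f → f ∈ M.Cw w T := by
    intro μ hμ hacc hfμ
    have hU : T ∪ M.mw μ w ⊆ M.accW w := Finset.union_subset hT (hμ.1.mw_subset w)
    refine mem_choice_of_subset (M.CwSub w) (h.2.2.1 w) Finset.subset_union_left hU hfT ?_
    rw [hμ.choice_eq_mw h hU Finset.subset_union_right]
    · exact mem_mw.2 hfμ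
    · intro g hg
      rcases Finset.mem_union.1 hg with hg | hg
      · exact hacc g hg
      · exact mem_choice_insert_of_mem hμ (mem_mw.1 hg)
  rcases mem_or_mem_of_mem_join hf with hf | hf
  exacts [aux A hA haccA hf, aux B hB haccB hf]

/-- A pair selected on both sides from two stable matchings belongs to the first one. -/
theorem mem_of_mem_join_of_mem_choice (h : M.PathIndepCM) (hA : M.Stable A) (hB : M.Stable B)
    {f : F} {w : W} (hJ : w ∈ M.join A B f) (hK : f ∈ M.Cw w (M.mw A w ∪ M.mw B w)) :
    w ∈ A f := by
  by_contra hwA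
  exact hA.2.2 f w ⟨join_isMatching hA.1 hB.1 f hJ, hwA,
    mem_choice_insert_of_mem_join h hA.1 hB.1 hJ,
    mem_choice_of_subset (M.CwSub w) (h.2.2.1 w)
      (Finset.insert_subset (M.CwSub w _ hK) Finset.subset_union_left)
      (Finset.union_subset (hA.1.mw_subset w) (hB.1.mw_subset w))
      (Finset.mem_insert_self _ _) hK⟩

theorem mw_join_inter_choice_subset (h : M.PathIndepCM) (hA : M.Stable A) (hB : M.Stable B)
    (w : W) : M.mw (M.join A B) w ∩ M.Cw w (M.mw A w ∪ M.mw B w) ⊆ M.mw A w ∩ M.mw B w := by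
  intro f hf
  obtain ⟨hJ, hK⟩ := Finset.mem_inter.1 hf
  rw [mem_mw] at hJ
  refine Finset.mem_inter.2 ⟨mem_mw.2 (mem_of_mem_join_of_mem_choice h hA hB hJ hK),
    mem_mw.2 (mem_of_mem_join_of_mem_choice h hB hA ?_ ?_)⟩
  · rwa [join_comm]
  · rwa [Finset.union_comm]

theorem mw_join_union_choice_subset (M : Market F W) (A B : F → Finset W) (w : W) :
    M.mw (M.join A B) w ∪ M.Cw w (M.mw A w ∪ M.mw B w) ⊆ M.mw A w ∪ M.mw B w := by
  refine Finset.union_subset (fun f hf => ?_) (M.CwSub w _)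
  simpa only [Finset.mem_union, mem_mw] using mem_or_mem_of_mem_join (mem_mw.1 hf)

theorem card_mw_le_card_choice (h : M.PathIndepCM) (hA : M.Stable A) (hB : M.Stable B) (w : W) :
    (M.mw B w).card ≤ (M.Cw w (M.mw A w ∪ M.mw B w)).card := by
  have := h.2.2.2 w _ _ (Finset.subset_union_right (s₁ := M.mw A w) (s₂ := M.mw B w))
    (Finset.union_subset (hA.1.mw_subset w) (hB.1.mw_subset w))
  rwa [hB.2.1.2 w] at this

/-- Every worker has the same number of partners under a stable matching and under its join
with another one. -/
theorem card_mw_join (h : M.PathIndepCM) (hA : M.Stable A) (hB : M.Stable B) (w : W) :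
    (M.mw (M.join A B) w).card = (M.mw A w).card := by
  have hle : ∀ v ∈ Finset.univ, (M.mw (M.join A B) v).card ≤ (M.mw A v).card := by
    intro v _
    have h1 := Finset.card_le_card (mw_join_inter_choice_subset h hA hB v)
    have h2 := Finset.card_le_card (mw_join_union_choice_subset M A B v)
    have h3 := Finset.card_union_add_card_inter (M.mw (M.join A B) v)
      (M.Cw v (M.mw A v ∪ M.mw B v))
    have h4 := Finset.card_union_add_card_inter (M.mw A v) (M.mw B v)
    have h5 := card_mw_le_card_choice h hA hB v
    omega
  have hge : ∑ v, (M.mw A v).card ≤ ∑ v, (M.mw (M.join A B) v).card := by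
    rw [sum_card_mw, sum_card_mw]
    refine Finset.sum_le_sum fun f _ => ?_
    have := h.2.1 f _ _ (Finset.subset_union_left (s₁ := A f) (s₂ := B f))
      (Finset.union_subset (hA.1 f) (hB.1 f))
    rwa [hA.2.1.1 f] at this
  exact (Finset.sum_eq_sum_iff_of_le hle).1 (le_antisymm (Finset.sum_le_sum hle) hge) w
    (Finset.mem_univ w)

/-- Each pair of two stable matchings is selected on the firm side or on the worker side. -/
theorem mw_join_union_choice (h : M.PathIndepCM) (hA : M.Stable A) (hB : M.Stable B) (w : W) :
    M.mw (M.join A B) w ∪ M.Cw w (M.mw A w ∪ M.mw B w) = M.mw A w ∪ M.mw B w := by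
  refine Finset.eq_of_subset_of_card_le (mw_join_union_choice_subset M A B w) ?_
  have h1 := Finset.card_le_card (mw_join_inter_choice_subset h hA hB w)
  have h3 := Finset.card_union_add_card_inter (M.mw (M.join A B) w)
    (M.Cw w (M.mw A w ∪ M.mw B w))
  have h4 := Finset.card_union_add_card_inter (M.mw A w) (M.mw B w)
  have h5 := card_mw_le_card_choice h hA hB w
  have h6 := card_mw_join h hA hB w
  omega

theorem dom_join (h : M.PathIndepCM) (hA : M.IsMatching A) (hB : M.IsMatching B) :
    M.Dom (M.join A B) A := by
  intro f
  have := h.1 f (A f ∪ B f) (Finset.union_subset (hA f) (hB f)) (A f) (hA f)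
  rw [Finset.union_eq_left.2 Finset.subset_union_left] at this
  exact this.symm

/-- A worker chosen by a firm on top of its join partners is chosen on top of its partners
in the first matching. -/
theorem mem_choice_insert_of_mem_choice_insert_join (h : M.PathIndepCM) (hA : M.IsMatching A)
    (hB : M.IsMatching B) {f : F} {w : W} (hacc : w ∈ M.accF f)
    (hw : w ∈ M.Cf f (insert w (M.join A B f))) : w ∈ M.Cf f (insert w (A f)) := by
  have hs : {w} ⊆ M.accF f := Finset.singleton_subset_iff.2 hacc
  have hAB : A f ∪ B f ⊆ M.accF f := Finset.union_subset (hA f) (hB f)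
  have key := h.1 f (A f ∪ B f) hAB {w} hs
  rw [Finset.insert_eq, Finset.union_comm, join, ← key] at hw
  refine mem_choice_of_subset (M.CfSub f) (h.1 f) ?_ (Finset.union_subset hAB hs)
    (Finset.mem_insert_self _ _) hw
  rw [Finset.insert_eq, Finset.union_comm]
  exact Finset.union_subset_union_left Finset.subset_union_left

theorem stable_join (h : M.PathIndepCM) (hA : M.Stable A) (hB : M.Stable B) :
    M.Stable (M.join A B) := by
  have hJ := join_isMatching hA.1 hB.1
  have haccA : ∀ f w, w ∈ M.join A B f → w ∈ M.Cf f (insert w (A f)) :=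
    fun f w hw => mem_choice_insert_of_mem_join h hA.1 hB.1 hw
  have haccB : ∀ f w, w ∈ M.join A B f → w ∈ M.Cf f (insert w (B f)) :=
    fun f w hw => mem_choice_insert_of_mem_join h hB.1 hA.1 (by rwa [join_comm])
  refine ⟨hJ, ⟨fun f => ?_, fun w => ?_⟩, ?_⟩
  · exact choice_eq_of_choice_subset (h.1 f) (M.CfSub f _)
      (Finset.union_subset (hA.1 f) (hB.1 f)) subset_rfl
  · refine (M.CwSub w _).antisymm fun f hf => ?_
    exact mem_choice_of_mem_join h hA hB (hJ.mw_subset w)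
      (fun g hg => haccA g w (mem_mw.1 hg)) (fun g hg => haccB g w (mem_mw.1 hg)) hf
      (mem_mw.1 hf)
  · rintro f w ⟨hacc, hnot, hCf, hCw⟩
    have hfA := mem_choice_insert_of_mem_choice_insert_join h hA.1 hB.1 hacc hCf
    have hfB := mem_choice_insert_of_mem_choice_insert_join h hB.1 hA.1 hacc
      (by rwa [join_comm])
    have hT : insert f (M.mw (M.join A B) w) ⊆ M.accW w :=
      Finset.insert_subset ((M.compat f w).2 hacc) (hJ.mw_subset w)
    have haccA' : ∀ g ∈ insert f (M.mw (M.join A B) w), w ∈ M.Cf g (insert w (A g)) := by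
      intro g hg
      rcases Finset.mem_insert.1 hg with rfl | hg
      exacts [hfA, haccA g w (mem_mw.1 hg)]
    have haccB' : ∀ g ∈ insert f (M.mw (M.join A B) w), w ∈ M.Cf g (insert w (B g)) := by
      intro g hg
      rcases Finset.mem_insert.1 hg with rfl | hg
      exacts [hfB, haccB g w (mem_mw.1 hg)]
    have hall : insert f (M.mw (M.join A B) w) ⊆
        M.Cw w (insert f (M.mw (M.join A B) w)) := by
      intro g hg
      rcases Finset.mem_insert.1 hg with rfl | hg'
      · exact hCw
      · exact mem_choice_of_mem_join h hA hB hT haccA' haccB' hg (mem_mw.1 hg')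
    have hU := Finset.union_subset hT (hA.1.mw_subset w)
    have hmono := h.2.2.2 w _ _ Finset.subset_union_left hU
    rw [hA.choice_eq_mw h hU Finset.subset_union_right] at hmono
    · have hcard := (Finset.card_le_card hall).trans hmono
      rw [Finset.card_insert_of_notMem (fun hf => hnot (mem_mw.1 hf)),
        card_mw_join h hA hB] at hcard
      omega
    · intro g hg
      rcases Finset.mem_union.1 hg with hg | hg
      · exact haccA' g hg
      · exact mem_choice_insert_of_mem hA (mem_mw.1 hg)

end Market

/-- In a matching market in which all choice functions are
path-independent and cardinal monotone, if `μ1` is stable and `w ∈ P_f(μ1)` for some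
firm `f` and worker `w`, then there is a stable matching `μ2` with `μ2 ⪰ μ1` and
`w ∈ μ2(f)`. -/
theorem stmt_12 {F W : Type*} [Fintype F] [Fintype W] [DecidableEq F] [DecidableEq W]
    (M : Market F W) (h : M.PathIndepCM)
    (μ1 : F → Finset W) (h1 : M.Stable μ1)
    (f : F) (w : W) (hw : w ∈ M.Pf μ1 f) :
    ∃ μ2 : F → Finset W, M.Stable μ2 ∧ M.Dom μ2 μ1 ∧ w ∈ μ2 f := by
  by_cases hwf : w ∈ μ1 f
  · exact ⟨μ1, h1, fun g => by rw [Finset.union_self, h1.2.1.1 g], hwf⟩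
  obtain ⟨⟨μ, hμ, hwμ⟩, hC⟩ := hw
  refine ⟨M.join μ1 μ, Market.stable_join h h1 hμ, Market.dom_join h h1.1 hμ.1, ?_⟩
  have hmem : f ∈ M.mw μ1 w ∪ M.mw μ w := Finset.mem_union_right _ (Market.mem_mw.2 hwμ)
  have hmem' := hmem
  rw [← Market.mw_join_union_choice h h1 hμ] at hmem'
  rcases Finset.mem_union.1 hmem' with hJ | hK
  · exact Market.mem_mw.1 hJ
  · exact absurd ⟨hμ.1 f hwμ, hwf, hC,
      mem_choice_of_subset (M.CwSub w) (h.2.2.1 w)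
        (Finset.insert_subset hmem Finset.subset_union_left)
        (Finset.union_subset (h1.1.mw_subset w) (hμ.1.mw_subset w))
        (Finset.mem_insert_self _ _) hK⟩ (h1.2.2 f w)
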